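/- The quotient of the Terwilliger F-algebra T of the factorial scheme by its Jacobson radical is isomorphic, as an F-algebra, to a finite direct sum of full matrix algebras over F. More precisely, T/Rad(T) ≅ ⊕_{g=1}^{n_≈} M_{|D(g)|}(F), where the equivalence classes are defined as follows: on the set of triples (A,B,C) of subsets of {1,…,n} with A Δ B ⊆ C ⊆ (A Δ B) ∪ Q(A∩B) and p ∤ k_B, declare (A,B,C) ≈ (A',B',C') iff Q(A∩C) \ B = Q(A'∩C') \ B'; n_≈ is the number of equivalence classes and D(g) = {A : (A,B,A) lies in the g-th class for some B}. -/

import Mathlib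

open Finset


variable {n : ℕ} {U : Fin n → Type*} [∀ i, Fintype (U i)] [∀ i, DecidableEq (U i)]
variable (F : Type*) [Field F]

/-- `D(y,z) = {i : y i ≠ z i}`. -/
def Dst (y z : ∀ i, U i) : Finset (Fin n) := univ.filter (fun i => y i ≠ z i)

/-- Adjacency matrix of the relation indexed by `S`. -/
def adjMat (S : Finset (Fin n)) : Matrix (∀ i, U i) (∀ i, U i) F :=
  fun y z => if Dst y z = S then 1 else 0

/-- Dual idempotent with respect to the base point `x`. -/
def dualIdem (x : ∀ i, U i) (S : Finset (Fin n)) : Matrix (∀ i, U i) (∀ i, U i) F :=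
  Matrix.diagonal (fun y => if Dst x y = S then 1 else 0)

/-- The Terwilliger `F`-algebra of the factorial scheme with base point `x`. -/
def TerwAlg (x : ∀ i, U i) : Subalgebra F (Matrix (∀ i, U i) (∀ i, U i) F) :=
  Algebra.adjoin F (Set.range (adjMat F) ∪ Set.range (dualIdem F x))

/-- The set of admissible triples `(A,B,C)` with `AΔB ⊆ C ⊆ (AΔB) ∪ Q(A∩B)` and `p ∤ k_B`. -/
def Dtriples (u : Fin n → ℕ) (p : ℕ) :
    Finset (Finset (Fin n) × Finset (Fin n) × Finset (Fin n)) :=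
  univ.filter (fun t => symmDiff t.1 t.2.1 ⊆ t.2.2 ∧
    t.2.2 ⊆ symmDiff t.1 t.2.1 ∪ (t.1 ∩ t.2.1).filter (fun i => 2 < u i) ∧
    ¬ p ∣ ∏ i ∈ t.2.1, (u i - 1))

/-- The invariant `Q(A∩C) \ B` defining the equivalence relation `≈` on triples. -/
def rmap (u : Fin n → ℕ) (t : Finset (Fin n) × Finset (Fin n) × Finset (Fin n)) :
    Finset (Fin n) :=
  (t.1 ∩ t.2.2).filter (fun i => 2 < u i) \ t.2.1

structure LP (K : Type*) where
  a : K
  b : K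
  c : K
  d : K
  e : K

def LP.mul {K : Type*} [Field K] (k : K) (p q : LP K) : LP K :=
  ⟨p.a * q.a + k * p.b * q.c, p.a * q.b + k * p.b * q.d + p.b * q.e,
   p.c * q.a + k * p.d * q.c + p.e * q.c, p.c * q.b + k * p.d * q.d + p.d * q.e + p.e * q.d,
   p.e * q.e⟩

def loc {K V : Type*} [Field K] [DecidableEq V] (x : V) (p : LP K) : Matrix V V K := fun y z =>
  if y = x then (if z = x then p.a else p.b)
  else if z = x then p.c else p.d + if y = z then p.e else 0

lemma loc_mul {K V : Type*} [Field K] [DecidableEq V] [Fintype V] (x : V) (p q : LP K) :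
    loc x p * loc x q = loc x (LP.mul ((Fintype.card V - 1 : ℕ) : K) p q) := by
  ext y z
  rw [Matrix.mul_apply, ← Finset.add_sum_erase _ _ (mem_univ x)]
  by_cases hy : y = x <;> by_cases hz : z = x
  · subst hy; subst hz
    rw [Finset.sum_congr rfl (g := fun _ => p.b * q.c)]
    · simp [loc, LP.mul]; ring
    · intro w hw; simp [loc, (mem_erase.1 hw).1]
  · subst hy
    rw [Finset.sum_congr rfl (g := fun w => p.b * q.d + if w = z then p.b * q.e else 0)]
    · rw [Finset.sum_add_distrib, Finset.sum_ite_eq']; simp [loc, LP.mul, hz]; ring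
    · intro w hw; simp [loc, (mem_erase.1 hw).1, hz]; split_ifs <;> ring
  · subst hz
    rw [Finset.sum_congr rfl (g := fun w => p.d * q.c + if y = w then p.e * q.c else 0)]
    · rw [Finset.sum_add_distrib, Finset.sum_ite_eq]; simp [loc, LP.mul, hy]; ring
    · intro w hw; simp [loc, (mem_erase.1 hw).1, hy]; split_ifs <;> ring
  · rw [Finset.sum_congr rfl (g := fun w => p.d * q.d + (if w = z then p.d * q.e else 0)
      + (if y = w then p.e * (q.d + if w = z then q.e else 0) else 0))]
    · rw [Finset.sum_add_distrib, Finset.sum_add_distrib, Finset.sum_ite_eq', Finset.sum_ite_eq]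
      simp [loc, LP.mul, hy, hz]
      by_cases hyz : y = z <;> simp [hyz] <;> ring
    · intro w hw; simp [loc, (mem_erase.1 hw).1, hy, hz]; split_ifs <;> ring

def tens {n : ℕ} {U : Fin n → Type*} {K : Type*} [Field K] (M : ∀ i, Matrix (U i) (U i) K) :
    Matrix (∀ i, U i) (∀ i, U i) K := fun y z => ∏ i, M i (y i) (z i)

lemma tens_mul {n : ℕ} {U : Fin n → Type*} [∀ i, Fintype (U i)] {K : Type*} [Field K]
    (M N : ∀ i, Matrix (U i) (U i) K) :
    tens M * tens N = tens (fun i => M i * N i) := by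
  ext y z
  simp only [tens, Matrix.mul_apply, Finset.prod_univ_sum, Fintype.piFinset_univ,
    Finset.prod_mul_distrib]

lemma sum_prod_fs {n : ℕ} {R : Type*} [CommSemiring R] (h : Fin n → Bool → R) :
    ∑ A : Finset (Fin n), ∏ i, h i (decide (i ∈ A)) = ∏ i, ∑ b, h i b := by
  simp only [Fintype.sum_bool]
  rw [Finset.prod_add, ← Finset.powerset_univ]
  refine Finset.sum_congr rfl fun A _ => ?_
  rw [← Finset.prod_sdiff (Finset.subset_univ A), mul_comm]
  congr 1
  · exact Finset.prod_congr rfl fun i hi => by simp [hi]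
  · exact Finset.prod_congr rfl fun i hi => by simp [(mem_sdiff.1 hi).2]

section
variable {K : Type*} [Field K]

lemma TL_loc_add {V : Type*} [DecidableEq V] (x : V) (p q r : LP K)
    (ha : p.a = q.a + r.a) (hb : p.b = q.b + r.b) (hc : p.c = q.c + r.c)
    (hd : p.d = q.d + r.d) (he : p.e = q.e + r.e) (y z : V) :
    loc x p y z = loc x q y z + loc x r y z := by
  simp only [loc, ha, hb, hc, hd, he]
  split_ifs <;> ring

open Classical in
noncomputable def al (k : K) (q : Prop) : Bool → Bool → Bool
  | true, a => decide (a = true ∧ q)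
  | false, a => decide (a = false ∨ k ≠ 0)

def rr (k : K) : Bool → Bool → Bool → LP K → K
  | true, _, _, p => p.e
  | false, false, false, p => p.a
  | false, false, true, p => k * p.b
  | false, true, false, p => p.c
  | false, true, true, p => k * p.d + p.e

def un (k : K) : Bool → Bool → Bool → LP K
  | true, _, _ => ⟨0, 0, 0, -k⁻¹, 1⟩
  | false, false, false => ⟨1, 0, 0, 0, 0⟩
  | false, false, true => ⟨0, k⁻¹, 0, 0, 0⟩
  | false, true, false => ⟨0, 0, 1, 0, 0⟩
  | false, true, true => ⟨0, 0, 0, k⁻¹, 0⟩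

lemma rr_un (k : K) (q : Prop) (κ a b κ' a' b' : Bool) (h1 : al k q κ a) (h2 : al k q κ b)
    (h3 : al k q κ' a') (h4 : al k q κ' b') :
    rr k κ' a' b' (un k κ a b) = if κ' = κ ∧ a' = a ∧ b' = b then 1 else 0 := by
  by_cases hk : k = 0 <;> by_cases hq : q <;> cases κ <;> cases κ' <;> cases a <;> cases a' <;>
    cases b <;> cases b' <;> simp_all [al, rr, un]

lemma rr_mul (k : K) (q : Prop) (κ a b : Bool) (h1 : al k q κ a) (h2 : al k q κ b) (P Q : LP K) :
    rr k κ a b (LP.mul k P Q) =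
      ∑ c, if al k q κ c then rr k κ a c P * rr k κ c b Q else 0 := by
  by_cases hk : k = 0 <;> by_cases hq : q <;> cases κ <;> cases a <;>
    cases b <;> simp_all [al, rr, LP.mul] <;> ring

lemma rr_one (k : K) (q : Prop) (κ a b : Bool) (h1 : al k q κ a) (h2 : al k q κ b) :
    rr k κ a b ⟨1, 0, 0, 0, 1⟩ = if a = b then 1 else 0 := by
  by_cases hk : k = 0 <;> by_cases hq : q <;> cases κ <;> cases a <;>
    cases b <;> simp_all [al, rr]

open Classical in
noncomputable def pp (k : K) (p : LP K) : LP K := if k = 0 then ⟨p.a, 0, 0, 0, p.e⟩ else p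

open Classical in
noncomputable def rp (k : K) (p : LP K) : LP K :=
  if k = 0 then ⟨0, p.b, p.c, p.d, 0⟩ else ⟨0, 0, 0, 0, 0⟩

def RadP (k : K) (p : LP K) : Prop :=
  p.a = 0 ∧ p.e = 0 ∧ (k = 0 ∨ (p.b = 0 ∧ p.c = 0 ∧ p.d = 0))

lemma radP_rp (k : K) (p : LP K) : RadP k (rp k p) := by
  by_cases hk : k = 0 <;> simp [rp, RadP, hk]

lemma RadP.mul_left {k : K} {q : LP K} (h : RadP k q) (p : LP K) : RadP k (LP.mul k p q) := by
  obtain ⟨h1, h2, rfl | ⟨h3, h4, h5⟩⟩ := h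
  · simp [LP.mul, RadP, h1, h2]
  · simp [LP.mul, RadP, h1, h2, h3, h4, h5]

lemma RadP.cube {k : K} {p q r : LP K} (hp : RadP k p) (hq : RadP k q) (hr : RadP k r) :
    LP.mul k (LP.mul k p q) r = ⟨0, 0, 0, 0, 0⟩ := by
  obtain ⟨h1, h2, rfl | ⟨h3, h4, h5⟩⟩ := hr
  · simp [LP.mul, h1, h2, hp.1, hq.1, hp.2.1, hq.2.1]
  · simp [LP.mul, h1, h2, h3, h4, h5]

lemma loc_zero {V : Type*} [DecidableEq V] (x y z : V) :
    loc x (⟨0, 0, 0, 0, 0⟩ : LP K) y z = 0 := by simp [loc]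

lemma loc_pp_rp {V : Type*} [DecidableEq V] (x : V) (k : K) (p : LP K) (y z : V) :
    loc x p y z = loc x (pp k p) y z + loc x (rp k p) y z := by
  by_cases hk : k = 0 <;> apply TL_loc_add <;> simp [pp, rp, hk]

lemma card_two_eq {V : Type*} [DecidableEq V] [Fintype V] (h2 : Fintype.card V = 2)
    (x y z : V) (hy : y ≠ x) (hz : z ≠ x) : y = z := by
  by_contra h
  have := Finset.card_le_univ ({x, y, z} : Finset V)
  rw [Finset.card_eq_three.2 ⟨x, y, z, hy.symm, hz.symm, h, rfl⟩] at this
  omega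

lemma loc_decomp {V : Type*} [DecidableEq V] [Fintype V] (h2 : 2 ≤ Fintype.card V) (x : V) (k : K)
    (hk : k = ((Fintype.card V - 1 : ℕ) : K)) (p : LP K) (y z : V) :
    loc x (pp k p) y z = ∑ κ, ∑ a, ∑ b, if al k (2 < Fintype.card V) κ a = true ∧
      al k (2 < Fintype.card V) κ b = true
      then rr k κ a b p * loc x (un k κ a b) y z else 0 := by
  by_cases h : 2 < Fintype.card V
  · by_cases hk0 : k = 0
    · simp [al, h, rr, un, hk0, pp, loc]
      split_ifs <;> ring
    · simp [al, h, rr, un, hk0, pp, loc]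
      split_ifs <;> field_simp <;> ring
  · have h3 : Fintype.card V = 2 := by omega
    have hk1 : k = 1 := by rw [hk, h3]; simp
    subst hk1
    simp [al, h, rr, un, pp, loc]
    have := card_two_eq h3 x y z
    split_ifs <;> first | (exfalso; tauto) | ring

def fv {V : Type*} [DecidableEq V] (x w w' : V) : Bool → Bool → V → K
  | true, _, z => (if z = w then 1 else 0) - (if z = w' then 1 else 0)
  | false, false, z => if z = x then 1 else 0
  | false, true, z => if z = x then 0 else 1

lemma rl_loc {V : Type*} [DecidableEq V] [Fintype V] (x w w' : V) (hw : w ≠ x)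
    (hw' : 2 < Fintype.card V → w' ≠ w ∧ w' ≠ x) (k : K)
    (hk : k = ((Fintype.card V - 1 : ℕ) : K)) (p : LP K) (κ a b : Bool)
    (h1 : al k (2 < Fintype.card V) κ a) (h2 : al k (2 < Fintype.card V) κ b) :
    ∑ z, loc x p (if a then w else x) z * fv x w w' κ b z = rr k κ a b p := by
  cases κ
  · cases b
    · cases a <;> simp [fv, loc, rr, hw]
    · rw [← Finset.add_sum_erase _ _ (mem_univ x)]
      cases a
      · rw [Finset.sum_congr rfl (g := fun _ => p.b)]
        · simp [fv, rr, hk]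
        · intro z hz; simp [fv, loc, (mem_erase.1 hz).1]
      · rw [Finset.sum_congr rfl (g := fun z => p.d + if w = z then p.e else 0)]
        · rw [Finset.sum_add_distrib, Finset.sum_ite_eq]
          simp [fv, rr, hk, hw]
        · intro z hz; simp [fv, loc, (mem_erase.1 hz).1, hw]
  · simp only [al, decide_eq_true_eq] at h1
    obtain ⟨rfl, hq⟩ := h1
    obtain ⟨h3, h4⟩ := hw' hq
    simp [fv, mul_sub, loc, rr, hw, h4, h3.symm]

end

section glob

abbrev kk (U : Fin n → Type*) [∀ i, Fintype (U i)] (i : Fin n) : F :=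
  ((Fintype.card (U i) - 1 : ℕ) : F)

abbrev qq (U : Fin n → Type*) [∀ i, Fintype (U i)] (i : Fin n) : Prop := 2 < Fintype.card (U i)

variable {F}

def TL (x : ∀ i, U i) (P : Fin n → LP F) : Matrix (∀ i, U i) (∀ i, U i) F :=
  tens (fun i => loc (x i) (P i))

lemma TL_mul (x : ∀ i, U i) (P Q : Fin n → LP F) :
    TL x P * TL x Q = TL x (fun i => LP.mul (kk F U i) (P i) (Q i)) := by
  simp only [TL, tens_mul, loc_mul, kk]

lemma TL_one (x : ∀ i, U i) : TL x (fun _ => (⟨1, 0, 0, 0, 1⟩ : LP F)) = 1 := by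
  ext y z
  have : ∀ i, loc (x i) (⟨1, 0, 0, 0, 1⟩ : LP F) (y i) (z i) = if y i = z i then 1 else 0 := by
    intro i
    simp only [loc]
    split_ifs <;> simp_all
  simp only [TL, tens, this, Fintype.prod_boole, Matrix.one_apply, funext_iff]
  congr

lemma TL_zero (x : ∀ i, U i) (P : Fin n → LP F) (i : Fin n) (h : P i = ⟨0, 0, 0, 0, 0⟩) :
    TL x P = 0 := by
  ext y z
  simp only [TL, tens, Matrix.zero_apply]
  exact Finset.prod_eq_zero (mem_univ i) (by rw [h, loc_zero])

lemma TL_add (x : ∀ i, U i) (P Q R : Fin n → LP F) (i : Fin n)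
    (hi : ∀ y z, loc (x i) (P i) y z = loc (x i) (Q i) y z + loc (x i) (R i) y z)
    (h1 : ∀ j, j ≠ i → Q j = P j) (h2 : ∀ j, j ≠ i → R j = P j) :
    TL x P - TL x Q = TL x R := by
  ext y z
  simp only [TL, tens, Matrix.sub_apply]
  rw [← Finset.mul_prod_erase _ _ (mem_univ i), ← Finset.mul_prod_erase _ _ (mem_univ i),
    ← Finset.mul_prod_erase _ _ (mem_univ i), hi,
    Finset.prod_congr (s₁ := univ.erase i) (f := fun j => loc (x j) (Q j) (y j) (z j)) rfl
      (fun j hj => by rw [h1 j (mem_erase.1 hj).1]),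
    Finset.prod_congr (s₁ := univ.erase i) (f := fun j => loc (x j) (R j) (y j) (z j)) rfl
      (fun j hj => by rw [h2 j (mem_erase.1 hj).1])]
  ring

lemma triple_mem (x : ∀ i, U i) (g : Finset (Fin n) → Finset (Fin n) → Finset (Fin n) → F)
    (t : Matrix (∀ i, U i) (∀ i, U i) F)
    (h : ∀ y z, t y z = g (Dst x y) (Dst y z) (Dst x z)) : t ∈ TerwAlg F x := by
  have : t = ∑ A, ∑ C, ∑ B, g A C B • (dualIdem F x A * adjMat F C * dualIdem F x B) := by
    ext y z
    simp only [Matrix.sum_apply, Matrix.smul_apply, dualIdem, Matrix.mul_diagonal,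
      Matrix.diagonal_mul, adjMat, smul_eq_mul, mul_ite, ite_mul, mul_one, mul_zero, zero_mul,
      one_mul]
    simp [h]
  rw [this]
  refine sum_mem fun A _ => sum_mem fun C _ => sum_mem fun B _ => ?_
  refine (TerwAlg F x).smul_mem ?_ _
  refine mul_mem (mul_mem ?_ ?_) ?_
  · exact Algebra.subset_adjoin (Or.inr ⟨A, rfl⟩)
  · exact Algebra.subset_adjoin (Or.inl ⟨C, rfl⟩)
  · exact Algebra.subset_adjoin (Or.inr ⟨B, rfl⟩)

lemma TL_mem (x : ∀ i, U i) (P : Fin n → LP F) : TL x P ∈ TerwAlg F x := by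
  refine triple_mem x (fun A C B => ∏ i, if i ∈ A then
      (if i ∈ B then (P i).d + (if i ∈ C then 0 else (P i).e) else (P i).c)
      else if i ∈ B then (P i).b else (P i).a) _ fun y z => ?_
  simp only [TL, tens]
  refine Finset.prod_congr rfl fun i _ => ?_
  simp only [loc, Dst, mem_filter, mem_univ, true_and, ne_eq, ite_not, eq_comm (a := x i)]

def SS (x : ∀ i, U i) : Submodule F (Matrix (∀ i, U i) (∀ i, U i) F) :=
  Submodule.span F (Set.range (TL x))

lemma adjMat_eq (x : ∀ i, U i) (S : Finset (Fin n)) :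
    adjMat F S = TL x (fun i => if i ∈ S then (⟨0, 1, 1, 1, -1⟩ : LP F) else ⟨1, 0, 0, 0, 1⟩) := by
  ext y z
  have : ∀ i, loc (x i) (if i ∈ S then (⟨0, 1, 1, 1, -1⟩ : LP F) else ⟨1, 0, 0, 0, 1⟩)
      (y i) (z i) = if (y i ≠ z i ↔ i ∈ S) then 1 else 0 := by
    intro i
    by_cases h : i ∈ S <;> simp only [loc, h, if_true, if_false] <;> split_ifs <;> simp_all
  simp only [TL, tens, this, Fintype.prod_boole, adjMat, Dst, Finset.ext_iff, mem_filter,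
    mem_univ, true_and]
  congr

lemma dualIdem_eq (x : ∀ i, U i) (S : Finset (Fin n)) :
    dualIdem F x S =
      TL x (fun i => if i ∈ S then (⟨0, 0, 0, 0, 1⟩ : LP F) else ⟨1, 0, 0, 0, 0⟩) := by
  ext y z
  have : ∀ i, loc (x i) (if i ∈ S then (⟨0, 0, 0, 0, 1⟩ : LP F) else ⟨1, 0, 0, 0, 0⟩)
      (y i) (z i) = if (y i = z i ∧ (x i ≠ y i ↔ i ∈ S)) then 1 else 0 := by
    intro i
    simp only [ne_eq, eq_comm (a := x i)]
    by_cases h : i ∈ S <;> simp only [loc, h, if_true, if_false] <;> split_ifs <;> simp_all <;> grind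
  simp only [TL, tens, this, Fintype.prod_boole, dualIdem, Dst, Finset.ext_iff, mem_filter,
    mem_univ, true_and, Matrix.diagonal_apply]
  rw [← ite_and]
  have hh : (∀ i, y i = z i ∧ (x i ≠ y i ↔ i ∈ S)) ↔ (y = z ∧ ∀ i, x i ≠ y i ↔ i ∈ S) := by
    rw [forall_and, funext_iff]
  simp only [hh]

lemma SS_mul (x : ∀ i, U i) {s t : Matrix (∀ i, U i) (∀ i, U i) F} (hs : s ∈ SS x)
    (ht : t ∈ SS x) : s * t ∈ SS x := by
  have h := Submodule.mul_mem_mul hs ht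
  rw [SS, Submodule.span_mul_span] at h
  refine Submodule.span_mono ?_ h
  rintro _ ⟨_, ⟨P, rfl⟩, _, ⟨Q, rfl⟩, rfl⟩
  exact ⟨_, (TL_mul x P Q).symm⟩

lemma mem_SS (x : ∀ i, U i) {t : Matrix (∀ i, U i) (∀ i, U i) F} (h : t ∈ TerwAlg F x) :
    t ∈ SS x := by
  have h1 : (1 : Matrix (∀ i, U i) (∀ i, U i) F) ∈ SS x :=
    Submodule.subset_span ⟨_, TL_one x⟩
  refine Algebra.adjoin_induction (p := fun t _ => t ∈ SS x) ?_ ?_ ?_ ?_ h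
  · rintro _ (⟨S, rfl⟩ | ⟨S, rfl⟩)
    · exact Submodule.subset_span ⟨_, (adjMat_eq x S).symm⟩
    · exact Submodule.subset_span ⟨_, (dualIdem_eq x S).symm⟩
  · intro r
    rw [Algebra.algebraMap_eq_smul_one]
    exact Submodule.smul_mem _ _ h1
  · intro a b _ _ ha hb
    exact add_mem ha hb
  · intro a b _ _ ha hb
    exact SS_mul x ha hb

/-- The Jacobson radical of `T`, as a subspace of the full matrix algebra. -/
def JS (x : ∀ i, U i) : Submodule F (Matrix (∀ i, U i) (∀ i, U i) F) :=
  ((Ideal.jacobson (⊥ : Ideal ↥(TerwAlg F x))).restrictScalars F).map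
    (TerwAlg F x).val.toLinearMap

lemma mem_JS (x : ∀ i, U i) (t : ↥(TerwAlg F x)) :
    (t : Matrix (∀ i, U i) (∀ i, U i) F) ∈ JS x ↔ t ∈ Ideal.jacobson (⊥ : Ideal ↥(TerwAlg F x)) := by
  constructor
  · rintro ⟨s, hs, h⟩
    have : s = t := Subtype.ext h
    exact this ▸ hs
  · intro h
    exact ⟨t, h, rfl⟩

def NI (x : ∀ i, U i) (i : Fin n) : Submodule F (Matrix (∀ i, U i) (∀ i, U i) F) :=
  Submodule.span F (TL x '' {P | RadP (kk F U i) (P i)})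

lemma NI_mul (x : ∀ i, U i) (i : Fin n) {s t : Matrix (∀ i, U i) (∀ i, U i) F} (hs : s ∈ SS x)
    (ht : t ∈ NI x i) : s * t ∈ NI x i := by
  have h := Submodule.mul_mem_mul hs ht
  rw [SS, NI, Submodule.span_mul_span] at h
  refine Submodule.span_mono ?_ h
  rintro _ ⟨_, ⟨P, rfl⟩, _, ⟨Q, hQ, rfl⟩, rfl⟩
  exact ⟨_, RadP.mul_left hQ _, (TL_mul x P Q).symm⟩

lemma NI_cube (x : ∀ i, U i) (i : Fin n) {t : Matrix (∀ i, U i) (∀ i, U i) F}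
    (ht : t ∈ NI x i) : t * t * t = 0 := by
  have h := Submodule.mul_mem_mul (Submodule.mul_mem_mul ht ht) ht
  rw [NI, Submodule.span_mul_span, Submodule.span_mul_span] at h
  rw [← Submodule.mem_bot (R := F)]
  refine (Submodule.span_le.2 ?_) h
  rintro _ ⟨_, ⟨_, ⟨P, hP, rfl⟩, _, ⟨Q, hQ, rfl⟩, rfl⟩, _, ⟨R, hR, rfl⟩, rfl⟩
  simp only [SetLike.mem_coe, Submodule.mem_bot, TL_mul]
  exact TL_zero x _ i (RadP.cube hP hQ hR)

lemma TL_mem_JS (x : ∀ i, U i) (P : Fin n → LP F) (i : Fin n) (h : RadP (kk F U i) (P i)) :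
    TL x P ∈ JS x := by
  refine (mem_JS x ⟨TL x P, TL_mem x P⟩).2 ?_
  rw [Ideal.mem_jacobson_iff]
  intro y
  have hn : IsNilpotent (y * ⟨TL x P, TL_mem x P⟩) := by
    refine ⟨3, Subtype.ext ?_⟩
    rw [pow_three']
    exact NI_cube x i (NI_mul x i (mem_SS x y.2) (Submodule.subset_span ⟨P, h, rfl⟩))
  obtain ⟨z, hz⟩ := hn.isUnit_one_add.exists_left_inv
  refine ⟨z, ?_⟩
  rw [Ideal.mem_bot, ← hz]
  noncomm_ring

lemma TL_sub_pp (x : ∀ i, U i) (P : Fin n → LP F) :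
    TL x P - TL x (fun i => pp (kk F U i) (P i)) ∈ JS x := by
  have key : ∀ s : Finset (Fin n),
      TL x P - TL x (fun i => if i ∈ s then pp (kk F U i) (P i) else P i) ∈ JS x := by
    intro s
    induction s using Finset.induction_on with
    | empty => simp
    | insert i s hi ih =>
      rw [← sub_add_sub_cancel _ (TL x (fun i => if i ∈ s then pp (kk F U i) (P i) else P i))]
      refine add_mem ih ?_
      rw [TL_add x _ _ (fun j => if j = i then rp (kk F U i) (P i) else
        if j ∈ s then pp (kk F U j) (P j) else P j) i]
      · exact TL_mem_JS x _ i (by simpa using radP_rp _ _)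
      · intro y z
        simpa [hi] using loc_pp_rp (x i) (kk F U i) (P i) y z
      · intro j hj; simp [hj]
      · intro j hj; simp [hj]
  simpa using key univ

/-- bits -/
abbrev bt (A : Finset (Fin n)) (i : Fin n) : Bool := decide (i ∈ A)

def psi (x w w' : ∀ i, U i) (v A B : Finset (Fin n)) :
    Matrix (∀ i, U i) (∀ i, U i) F →ₗ[F] F where
  toFun t := ∑ z, t (fun i => if bt A i then w i else x i) z *
    ∏ i, fv (x i) (w i) (w' i) (bt v i) (bt B i) (z i)
  map_add' s t := by simp [add_mul, Finset.sum_add_distrib]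
  map_smul' c t := by simp [Finset.mul_sum, mul_assoc]

def DD (F : Type*) [Field F] (U : Fin n → Type*) [∀ i, Fintype (U i)] (v A : Finset (Fin n)) : Prop :=
  ∀ i, al (kk F U i) (qq U i) (bt v i) (bt A i) = true

structure WW (x w w' : ∀ i, U i) : Prop where
  h1 : ∀ i, w i ≠ x i
  h2 : ∀ i, qq U i → w' i ≠ w i ∧ w' i ≠ x i

lemma psi_TL {x w w' : ∀ i, U i} (H : WW x w w') (v A B : Finset (Fin n)) (hA : DD F U v A)
    (hB : DD F U v B) (P : Fin n → LP F) :
    psi x w w' v A B (TL x P) = ∏ i, rr (kk F U i) (bt v i) (bt A i) (bt B i) (P i) := by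
  simp only [psi, LinearMap.coe_mk, AddHom.coe_mk, TL, tens, ← Finset.prod_mul_distrib]
  rw [← Fintype.piFinset_univ, ← Finset.prod_univ_sum (fun i => (univ : Finset (U i)))
    (fun i z => loc (x i) (P i) (if bt A i then w i else x i) z *
      fv (x i) (w i) (w' i) (bt v i) (bt B i) z)]
  refine Finset.prod_congr rfl fun i _ => ?_
  exact rl_loc (x i) (w i) (w' i) (H.h1 i) (H.h2 i) _ rfl (P i) _ _ _ (hA i) (hB i)

lemma psi_mul {x w w' : ∀ i, U i} (H : WW x w w') (v A B : Finset (Fin n)) (hA : DD F U v A)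
    (hB : DD F U v B) (E : Finset (Finset (Fin n))) (hE : ∀ C, C ∈ E ↔ DD F U v C)
    {s t : Matrix (∀ i, U i) (∀ i, U i) F} (hs : s ∈ SS x) (ht : t ∈ SS x) :
    psi x w w' v A B (s * t) = ∑ C ∈ E, psi x w w' v A C s * psi x w w' v C B t := by
  induction hs using Submodule.span_induction with
  | zero => simp
  | add a b _ _ ha hb => simp [add_mul, Finset.sum_add_distrib, ha, hb]
  | smul c a _ ha => simp [ha, Finset.mul_sum, mul_assoc]
  | mem s hs =>
    obtain ⟨P, rfl⟩ := hs
    induction ht using Submodule.span_induction with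
    | zero => simp
    | add a b _ _ ha hb => simp [mul_add, Finset.sum_add_distrib, ha, hb]
    | smul c a _ ha => simp [ha, Finset.mul_sum, mul_left_comm]
    | mem t ht =>
      obtain ⟨Q, rfl⟩ := ht
      rw [TL_mul, psi_TL H v A B hA hB]
      have h1 : ∀ i, rr (kk F U i) (bt v i) (bt A i) (bt B i) (LP.mul (kk F U i) (P i) (Q i)) = _ :=
        fun i => rr_mul _ _ _ _ _ (hA i) (hB i) _ _
      simp only [h1]
      rw [← sum_prod_fs (fun i c => if al (kk F U i) (qq U i) (bt v i) c = true then
        rr (kk F U i) (bt v i) (bt A i) c (P i) * rr (kk F U i) (bt v i) c (bt B i) (Q i) else 0)]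
      have : E = univ.filter (fun C => C ∈ E) := by simp
      rw [this, Finset.sum_filter]
      refine Finset.sum_congr rfl fun C _ => ?_
      rw [Fintype.prod_ite_zero]
      by_cases hC : DD F U v C
      · have hC' : ∀ i, al (kk F U i) (qq U i) (bt v i) (decide (i ∈ C)) = true := hC
        rw [if_pos hC', if_pos ((hE C).2 hC), psi_TL H v A C hA hC, psi_TL H v C B hC hB,
          Finset.prod_mul_distrib]
      · have hC' : ¬ ∀ i, al (kk F U i) (qq U i) (bt v i) (decide (i ∈ C)) = true := hC
        rw [if_neg hC', if_neg (fun h => hC ((hE C).1 h))]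

lemma bt_ext {A B : Finset (Fin n)} : (∀ i, bt A i = bt B i) ↔ A = B := by
  simp [bt, Finset.ext_iff]

lemma psi_one {x w w' : ∀ i, U i} (H : WW x w w') (v A B : Finset (Fin n)) (hA : DD F U v A)
    (hB : DD F U v B) :
    psi x w w' v A B (1 : Matrix (∀ i, U i) (∀ i, U i) F) = if A = B then 1 else 0 := by
  rw [← TL_one x, psi_TL H v A B hA hB,
    Finset.prod_congr rfl (fun i _ => rr_one _ _ _ _ _ (hA i) (hB i)), Fintype.prod_boole]
  simp only [bt_ext]

def TU (x : ∀ i, U i) (v A B : Finset (Fin n)) : Matrix (∀ i, U i) (∀ i, U i) F :=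
  TL x (fun i => un (kk F U i) (bt v i) (bt A i) (bt B i))

lemma psi_TU {x w w' : ∀ i, U i} (H : WW x w w') (v A B v' A' B' : Finset (Fin n))
    (hA : DD F U v A) (hB : DD F U v B) (hA' : DD F U v' A') (hB' : DD F U v' B') :
    psi x w w' v' A' B' (TU x v A B : Matrix (∀ i, U i) (∀ i, U i) F) =
      if v' = v ∧ A' = A ∧ B' = B then 1 else 0 := by
  rw [TU, psi_TL H v' A' B' hA' hB',
    Finset.prod_congr rfl
      (fun i _ => rr_un _ _ _ _ _ _ _ _ (hA i) (hB i) (hA' i) (hB' i)), Fintype.prod_boole]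
  simp only [forall_and, bt_ext]

lemma TL_pp_eq {x w w' : ∀ i, U i} (H : WW x w w') (h2 : ∀ i, 2 ≤ Fintype.card (U i))
    (E : Finset (Fin n) → Finset (Finset (Fin n))) (hE : ∀ v C, C ∈ E v ↔ DD F U v C)
    (P : Fin n → LP F) :
    TL x (fun i => pp (kk F U i) (P i)) =
      ∑ v, ∑ A ∈ E v, ∑ B ∈ E v, psi x w w' v A B (TL x P) • TU x v A B := by
  ext y z
  simp only [TL, tens]
  have h1 : ∀ i, loc (x i) (pp (kk F U i) (P i)) (y i) (z i) = _ :=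
    fun i => loc_decomp (h2 i) (x i) (kk F U i) rfl (P i) (y i) (z i)
  simp only [h1]
  rw [← sum_prod_fs (fun i κ => ∑ a, ∑ b, if al (kk F U i) (qq U i) κ a = true ∧
      al (kk F U i) (qq U i) κ b = true
      then rr (kk F U i) κ a b (P i) * loc (x i) (un (kk F U i) κ a b) (y i) (z i) else 0)]
  simp only [Matrix.sum_apply, Matrix.smul_apply]
  refine Finset.sum_congr rfl fun v _ => ?_
  rw [← sum_prod_fs (fun i a => ∑ b, if al (kk F U i) (qq U i) (bt v i) a = true ∧
      al (kk F U i) (qq U i) (bt v i) b = true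
      then rr (kk F U i) (bt v i) a b (P i) *
        loc (x i) (un (kk F U i) (bt v i) a b) (y i) (z i) else 0)]
  have h3 : E v = univ.filter (fun C => C ∈ E v) := by simp
  rw [h3, Finset.sum_filter]
  refine Finset.sum_congr rfl fun A _ => ?_
  rw [← sum_prod_fs (fun i b => if al (kk F U i) (qq U i) (bt v i) (bt A i) = true ∧
      al (kk F U i) (qq U i) (bt v i) b = true
      then rr (kk F U i) (bt v i) (bt A i) b (P i) *
        loc (x i) (un (kk F U i) (bt v i) (bt A i) b) (y i) (z i) else 0)]
  rw [Finset.sum_filter]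
  by_cases hA : DD F U v A
  · rw [if_pos ((hE v A).2 hA)]
    refine Finset.sum_congr rfl fun B _ => ?_
    rw [Fintype.prod_ite_zero]
    by_cases hB : DD F U v B
    · rw [if_pos ((hE v B).2 hB), if_pos (fun i => ⟨hA i, hB i⟩), Finset.prod_mul_distrib]
      have := psi_TL H v A B hA hB P
      rw [TL] at this
      rw [← this]
      rfl
    · rw [if_neg (fun h => hB ((hE v B).1 h)), if_neg (fun h => hB fun i => (h i).2)]
  · rw [if_neg (fun h => hA ((hE v A).1 h))]
    refine Finset.sum_eq_zero fun B _ => ?_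
    rw [Fintype.prod_ite_zero, if_neg (fun h => hA fun i => (h i).1)]

lemma sub_mem_JS {x w w' : ∀ i, U i} (H : WW x w w') (h2 : ∀ i, 2 ≤ Fintype.card (U i))
    (E : Finset (Fin n) → Finset (Finset (Fin n))) (hE : ∀ v C, C ∈ E v ↔ DD F U v C)
    {t : Matrix (∀ i, U i) (∀ i, U i) F} (ht : t ∈ SS x) :
    t - ∑ v, ∑ A ∈ E v, ∑ B ∈ E v, psi x w w' v A B t • TU x v A B ∈ JS x := by
  induction ht using Submodule.span_induction with
  | zero => simp
  | add a b _ _ ha hb =>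
    have := add_mem ha hb
    simp only [map_add, add_smul, Finset.sum_add_distrib]
    convert this using 1
    abel
  | smul c a _ ha =>
    have := Submodule.smul_mem _ c ha
    simpa only [map_smul, smul_sub, Finset.smul_sum, smul_smul, smul_eq_mul] using this
  | mem t ht =>
    obtain ⟨P, rfl⟩ := ht
    rw [← TL_pp_eq H h2 E hE]
    exact TL_sub_pp x P

theorem main_aux (x w w' : ∀ i, U i) (H : WW x w w') (h2 : ∀ i, 2 ≤ Fintype.card (U i))
    (E : Finset (Fin n) → Finset (Finset (Fin n))) (hE : ∀ v C, C ∈ E v ↔ DD F U v C)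
    (classes : Finset (Finset (Fin n))) (hcl : ∀ v A, A ∈ E v → v ∈ classes) :
    ∃ φ : ↥(TerwAlg F x) →ₐ[F]
        (∀ v : ↑classes, Matrix (Fin (E ↑v).card) (Fin (E ↑v).card) F),
      Function.Surjective φ ∧
        ∀ t : ↥(TerwAlg F x), φ t = 0 ↔ t ∈ Ideal.jacobson (⊥ : Ideal ↥(TerwAlg F x)) := by
  classical
  let e : ∀ v, Fin (E v).card ≃ E v := fun v => (E v).equivFin.symm
  have he : ∀ v a, DD F U v (e v a) := fun v a => (hE v _).1 (e v a).2
  let φ₁ : ∀ v : ↑classes, ↥(TerwAlg F x) →ₐ[F]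
      Matrix (Fin (E ↑v).card) (Fin (E ↑v).card) F := fun v =>
    AlgHom.ofLinearMap
      { toFun := fun t => Matrix.of fun a b => psi x w w' v (e v a) (e v b) t.1
        map_add' := fun s t => by ext a b; simp
        map_smul' := fun c t => by ext a b; simp }
      (by
        ext a b
        have := psi_one H v _ _ (he v a) (he v b)
        simpa [Matrix.one_apply, Subtype.ext_iff.symm] using this)
      (by
        intro s t
        ext a b
        have := psi_mul H v _ _ (he v a) (he v b) (E v) (hE v) (mem_SS x s.2) (mem_SS x t.2)
        rw [← Finset.sum_coe_sort, ← (e v).sum_comp] at this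
        simpa [Matrix.mul_apply] using this)
  let φ := AlgHom.pi φ₁
  have hφ : ∀ t v a b, φ t v a b = psi x w w' v (e v a) (e v b) t.1 := fun _ _ _ _ => rfl
  have hsurj : Function.Surjective φ := by
    intro m
    refine ⟨∑ v, ∑ a, ∑ b, m v a b • ⟨TU x v (e v a) (e v b), TL_mem x _⟩, ?_⟩
    ext v' a' b'
    have h3 : ∀ (v : ↑classes) (a b : Fin (E ↑v).card),
        φ ⟨TU x v (e v a) (e v b), TL_mem x _⟩ v' a' b' =
          if (v' : Finset (Fin n)) = v ∧ (e v' a' : Finset (Fin n)) = e v a ∧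
            (e v' b' : Finset (Fin n)) = e v b then 1 else 0 := by
      intro v a b
      rw [hφ]
      exact psi_TU H _ _ _ _ _ _ (he v a) (he v b) (he v' a') (he v' b')
    simp only [map_sum, map_smul, Finset.sum_apply, Matrix.sum_apply, Pi.smul_apply,
      Matrix.smul_apply, h3]
    rw [Finset.sum_eq_single v', Finset.sum_eq_single a', Finset.sum_eq_single b']
    · simp
    · intro b _ hb
      rw [if_neg]
      · simp
      · rintro ⟨-, -, h⟩
        exact hb ((e v').injective (Subtype.ext h)).symm
    · simp
    · intro a _ ha
      refine Finset.sum_eq_zero fun b _ => ?_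
      rw [if_neg]
      · simp
      · rintro ⟨-, h, -⟩
        exact ha ((e v').injective (Subtype.ext h)).symm
    · simp
    · intro v _ hv
      refine Finset.sum_eq_zero fun a _ => Finset.sum_eq_zero fun b _ => ?_
      rw [if_neg]
      · simp
      · rintro ⟨h, -, -⟩
        exact hv (Subtype.ext h).symm
    · simp
  refine ⟨φ, hsurj, fun t => ⟨fun h => ?_, fun h => ?_⟩⟩
  · have h3 := sub_mem_JS H h2 E hE (mem_SS x t.2)
    rw [Finset.sum_eq_zero, sub_zero] at h3
    · exact (mem_JS x t).1 h3
    · intro v _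
      refine Finset.sum_eq_zero fun A hA => Finset.sum_eq_zero fun B hB => ?_
      have h4 := hφ t ⟨v, hcl v A hA⟩ ((e v).symm ⟨A, hA⟩) ((e v).symm ⟨B, hB⟩)
      rw [h] at h4
      simp only [Equiv.apply_symm_apply] at h4
      rw [← h4]
      simp
  · rw [Ideal.jacobson_bot] at h
    have : RingHomSurjective φ.toRingHom := ⟨hsurj⟩
    have h5 := Ring.le_comap_jacobson φ.toRingHom h
    rw [Ideal.mem_comap, IsSemisimpleRing.jacobson_eq_bot] at h5
    exact h5

end glob

set_option synthInstance.maxHeartbeats 1000000 in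
theorem stmt_19 (hn : 1 ≤ n) (u : Fin n → ℕ) (hu : ∀ i, Fintype.card (U i) = u i)
    (h2 : ∀ i, 2 ≤ u i) (x : ∀ i, U i) (p : ℕ) (hp : CharP F p)
    (classes : Finset (Finset (Fin n)))
    (hclasses : classes = (Dtriples u p).image (rmap u))
    (Dg : Finset (Fin n) → Finset (Finset (Fin n)))
    (hDg : ∀ v, Dg v = univ.filter
      (fun A => ∃ B, (A, B, A) ∈ Dtriples u p ∧ rmap u (A, B, A) = v)) :
    ∃ φ : ↥(TerwAlg F x) →ₐ[F]
        (∀ v : ↑classes, Matrix (Fin (Dg ↑v).card) (Fin (Dg ↑v).card) F),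
      Function.Surjective φ ∧
        ∀ t : ↥(TerwAlg F x), φ t = 0 ↔ t ∈ Ideal.jacobson (⊥ : Ideal ↥(TerwAlg F x)) := by
  subst hclasses
  have hc : ∀ i, 2 ≤ Fintype.card (U i) := fun i => (hu i).symm ▸ h2 i
  have hw : ∀ i, ∃ w : U i, w ≠ x i := by
    intro i
    have : Nontrivial (U i) := Fintype.one_lt_card_iff_nontrivial.1 (hc i)
    exact exists_ne _
  choose w hw using hw
  have hw' : ∀ i, ∃ w' : U i, qq U i → w' ≠ w i ∧ w' ≠ x i := by
    intro i
    by_cases hq : qq U i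
    · obtain ⟨a, ha⟩ : ∃ a, a ∉ ({w i, x i} : Finset (U i)) := by
        by_contra! hcon
        have h3 := Finset.card_le_two (a := w i) (b := x i)
        rw [Finset.eq_univ_iff_forall.2 hcon, Finset.card_univ] at h3
        simp only [qq] at hq
        omega
      exact ⟨a, fun _ => by simpa using ha⟩
    · exact ⟨x i, fun h => absurd h hq⟩
  choose w' hw' using hw'
  refine main_aux x w w' ⟨hw, hw'⟩ hc Dg ?_ _ ?_
  · intro v A
    have hk : ∀ i, kk F U i = 0 ↔ p ∣ u i - 1 := by
      intro i
      rw [kk, hu i, CharP.cast_eq_zero_iff F p]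
    have hpp : ∀ s : Finset (Fin n), p ∣ ∏ i ∈ s, (u i - 1) ↔ ∃ i ∈ s, p ∣ u i - 1 := by
      intro s
      simp only [← CharP.cast_eq_zero_iff F p, Nat.cast_prod, Finset.prod_eq_zero_iff]
    have hp1 : ¬ p ∣ 1 := by
      rw [← CharP.cast_eq_zero_iff F p]; simp
    have hal : DD F U v A ↔ ∀ i, (i ∈ v → i ∈ A ∧ 2 < u i) ∧ (i ∉ v → i ∈ A → ¬ p ∣ u i - 1) := by
      refine forall_congr' fun i => ?_
      by_cases hv : i ∈ v <;> by_cases hA : i ∈ A <;> simp [al, bt, hv, hA, hk, hu, qq]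
    rw [hal, hDg]
    simp only [mem_filter, mem_univ, true_and, Dtriples, rmap, hpp]
    constructor
    · rintro ⟨B, ⟨h1, h3, h4⟩, rfl⟩ i
      have h1i := @h1 i
      have h3i := @h3 i
      simp only [mem_symmDiff, mem_union, mem_inter, mem_filter, mem_sdiff] at h1i h3i ⊢
      refine ⟨fun h => by tauto, fun h hA hd => h4 ⟨i, ?_, hd⟩⟩
      by_contra hB
      have : ¬ 2 < u i := by tauto
      have h5 : u i - 1 = 1 := by have := h2 i; omega
      rw [h5] at hd
      exact hp1 hd
    · intro h
      refine ⟨A.filter (fun i => 2 < u i) \ v, ⟨?_, ?_, ?_⟩, ?_⟩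
      · intro i
        simp only [mem_symmDiff, mem_filter, mem_sdiff]
        tauto
      · intro i
        have := h i
        simp only [mem_symmDiff, mem_union, mem_inter, mem_filter, mem_sdiff]
        tauto
      · rintro ⟨i, hi, hd⟩
        have := h i
        simp only [mem_filter, mem_sdiff] at hi
        tauto
      · ext i
        have := h i
        simp only [mem_inter, mem_filter, mem_sdiff]
        tauto
  · intro v A hA
    rw [hDg] at hA
    obtain ⟨B, hB, hv⟩ := (mem_filter.1 hA).2
    exact mem_image.2 ⟨_, hB, hv⟩
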